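/- arXiv:2007.15924 — 2 statements merged into one kernel-verified Lean document; each statement's English description precedes it below -/
import Mathlib

section
/- Let σ > 0, define f_σ : ℝ → ℝ by f_σ(x) = (x/σ)·exp(−x²/σ²), let A and B be nonempty compact subsets of ℝ², and let q ∈ ℝ². Then |f_σ(d(q, A)) − f_σ(d(q, B))| ≤ (1/σ)·d_H(A, B), where d(q, S) = inf_{p ∈ S} ‖q − p‖ and d_H is the Hausdorff distance. -/
theorem abs_one_sub_two_mul_mul_exp_neg_le_one {u : ℝ} (hu : 0 ≤ u) :
    |(1 - 2 * u) * Real.exp (-u)| ≤ 1 := by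
  rw [abs_mul, Real.abs_exp, Real.exp_neg, ← div_eq_mul_inv, div_le_one (Real.exp_pos u), abs_le]
  have h := Real.quadratic_le_exp_of_nonneg hu
  constructor <;> nlinarith [sq_nonneg (u - 1)]

theorem hasDerivAt_mul_exp_neg_sq (t : ℝ) :
    HasDerivAt (fun t : ℝ => t * Real.exp (-t ^ 2)) ((1 - 2 * t ^ 2) * Real.exp (-t ^ 2)) t := by
  have hexp : HasDerivAt (fun t : ℝ => Real.exp (-t ^ 2)) (Real.exp (-t ^ 2) * -(2 * t)) t := by
    simpa using (hasDerivAt_pow 2 t).fun_neg.exp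
  exact ((hasDerivAt_id' t).fun_mul hexp).congr_deriv (by ring)

theorem lipschitzWith_mul_exp_neg_sq :
    LipschitzWith 1 (fun t : ℝ => t * Real.exp (-t ^ 2)) := by
  refine lipschitzWith_of_nnnorm_deriv_le
    (fun t => (hasDerivAt_mul_exp_neg_sq t).differentiableAt) fun t => ?_
  rw [(hasDerivAt_mul_exp_neg_sq t).deriv, ← NNReal.coe_le_coe, coe_nnnorm, Real.norm_eq_abs]
  exact abs_one_sub_two_mul_mul_exp_neg_le_one (sq_nonneg t)

theorem abs_infDist_sub_infDist_le_hausdorffDist {X : Type*} [PseudoMetricSpace X] {s t : Set X}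
    (h : Metric.hausdorffEDist s t ≠ ⊤) (x : X) :
    |Metric.infDist x s - Metric.infDist x t| ≤ Metric.hausdorffDist s t := by
  have hst := Metric.infDist_le_infDist_add_hausdorffDist (x := x) h
  have hts := Metric.infDist_le_infDist_add_hausdorffDist (x := x)
    (Metric.hausdorffEDist_comm (s := s) (t := t) ▸ h)
  rw [Metric.hausdorffDist_comm] at hts
  exact abs_sub_le_iff.2 ⟨by linarith, by linarith⟩

open Metric in
/-- The weighted minDist feature values of two nonempty compact sets
differ by at most `(1/σ)` times their Hausdorff distance. -/
theorem weight_infDist_stable_hausdorff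
    (σ : ℝ) (hσ : 0 < σ)
    (A B : Set (EuclideanSpace ℝ (Fin 2)))
    (hAne : A.Nonempty) (hBne : B.Nonempty)
    (hA : IsCompact A) (hB : IsCompact B)
    (q : EuclideanSpace ℝ (Fin 2)) :
    |(infDist q A / σ) * Real.exp (-(infDist q A ^ 2) / σ ^ 2)
      - (infDist q B / σ) * Real.exp (-(infDist q B ^ 2) / σ ^ 2)|
      ≤ (1 / σ) * hausdorffDist A B := by
  have hfin := hausdorffEDist_ne_top_of_nonempty_of_bounded hAne hBne hA.isBounded hB.isBounded
  have hlip := lipschitzWith_mul_exp_neg_sq.dist_le_mul (infDist q A / σ) (infDist q B / σ)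
  simp only [Real.dist_eq, div_pow, ← neg_div, NNReal.coe_one, one_mul] at hlip
  calc _ ≤ |infDist q A / σ - infDist q B / σ| := hlip
    _ = 1 / σ * |infDist q A - infDist q B| := by
      rw [← sub_div, abs_div, abs_of_pos hσ, div_eq_mul_one_div, mul_comm]
    _ ≤ 1 / σ * hausdorffDist A B := by
      gcongr
      exact abs_infDist_sub_infDist_le_hausdorffDist hfin q
end

section
/- Let σ > 0, define f_σ : ℝ → ℝ by f_σ(x) = (x/σ)·exp(−x²/σ²), let γ, γ′ : [0,1] → ℝ² be continuous curves, and let q ∈ ℝ². Then |f_σ(d(q, γ([0,1]))) − f_σ(d(q, γ′([0,1])))| ≤ (1/σ)·d_F(γ, γ′), where d(q, S) = inf_{p ∈ S} ‖q − p‖ and d_F(γ, γ′) is the infimum, over all pairs (φ, ψ) of continuous nondecreasing surjections from [0,1] onto [0,1], of sup_{t ∈ [0,1]} ‖γ(φ(t)) − γ′(ψ(t))‖. -/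
/-- The function `u ↦ u * exp (-u ^ 2)` is `1`-Lipschitz. -/
theorem abs_mul_exp_neg_sq_sub_le (u v : ℝ) :
    |u * Real.exp (-u ^ 2) - v * Real.exp (-v ^ 2)| ≤ |u - v| := by
  have hderiv : ∀ x : ℝ, HasDerivAt (fun y : ℝ => y * Real.exp (-y ^ 2))
      ((1 - 2 * x ^ 2) * Real.exp (-x ^ 2)) x := by
    intro x
    have h := (hasDerivAt_id x).mul ((hasDerivAt_pow 2 x).neg.exp)
    refine h.congr_deriv ?_
    simp only [id, Pi.neg_apply]
    push_cast
    ring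
  have hbound : ∀ x : ℝ, ‖(1 - 2 * x ^ 2) * Real.exp (-x ^ 2)‖ ≤ 1 := by
    intro x
    have hquad := Real.quadratic_le_exp_of_nonneg (sq_nonneg x)
    rw [Real.norm_eq_abs, abs_mul, Real.abs_exp, Real.exp_neg, ← div_eq_mul_inv,
      div_le_one (Real.exp_pos _), abs_le]
    constructor <;> nlinarith [sq_nonneg (x ^ 2 - 1), sq_nonneg x]
  have h := convex_univ.norm_image_sub_le_of_norm_hasDerivWithin_le
    (fun x _ => (hderiv x).hasDerivWithinAt) (fun x _ => hbound x)
    (Set.mem_univ v) (Set.mem_univ u)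
  simpa [Real.norm_eq_abs] using h

/-- If every point of the range of `f` is within `r` of some point of the range of `g`, then
the distance to the range of `g` exceeds the distance to the range of `f` by at most `r`. -/
theorem Metric.infDist_range_le_infDist_range_add {ι κ X : Type*} [Nonempty ι]
    [PseudoMetricSpace X] {f : ι → X} {g : κ → X} {r : ℝ}
    (h : ∀ i, ∃ j, dist (f i) (g j) ≤ r) (q : X) :
    infDist q (Set.range g) ≤ infDist q (Set.range f) + r := by
  rw [← sub_le_iff_le_add, le_infDist (Set.range_nonempty f)]
  rintro _ ⟨i, rfl⟩
  obtain ⟨j, hj⟩ := h i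
  have hq := infDist_le_dist_of_mem (x := q) (Set.mem_range_self (f := g) j)
  linarith [dist_triangle q (f i) (g j)]

/-- The distances from a point to the ranges of two curves differ by at most the uniform
distance between surjective reparametrizations of the curves. -/
theorem Metric.abs_infDist_range_sub_le_iSup {T ι κ E : Type*} [Nonempty T]
    [SeminormedAddCommGroup E] {f : ι → E} {g : κ → E} {φ : T → ι} {ψ : T → κ}
    (hφ : Function.Surjective φ) (hψ : Function.Surjective ψ)
    (hbdd : BddAbove (Set.range fun t => ‖f (φ t) - g (ψ t)‖)) (q : E) :
    |infDist q (Set.range f) - infDist q (Set.range g)| ≤ ⨆ t, ‖f (φ t) - g (ψ t)‖ := by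
  have hle : ∀ t, dist (f (φ t)) (g (ψ t)) ≤ ⨆ t, ‖f (φ t) - g (ψ t)‖ := fun t => by
    rw [dist_eq_norm]
    exact le_ciSup hbdd t
  have : Nonempty ι := Nonempty.map φ inferInstance
  have : Nonempty κ := Nonempty.map ψ inferInstance
  rw [abs_sub_le_iff, sub_le_iff_le_add', sub_le_iff_le_add']
  constructor
  · refine infDist_range_le_infDist_range_add (fun j => ?_) q
    obtain ⟨t, rfl⟩ := hψ j
    exact ⟨φ t, dist_comm (g (ψ t)) _ ▸ hle t⟩
  · refine infDist_range_le_infDist_range_add (fun i => ?_) q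
    obtain ⟨t, rfl⟩ := hφ i
    exact ⟨ψ t, hle t⟩

open Metric in
/-- The weighted minDist feature values of two continuous curves differ
by at most `(1/σ)` times their Fréchet distance, defined as the infimum over pairs of
continuous nondecreasing surjective reparametrizations of the uniform distance. -/
theorem weight_infDist_stable_frechet
    (σ : ℝ) (hσ : 0 < σ)
    (γ γ' : Set.Icc (0 : ℝ) 1 → EuclideanSpace ℝ (Fin 2))
    (hγ : Continuous γ) (hγ' : Continuous γ')
    (q : EuclideanSpace ℝ (Fin 2)) :
    |(infDist q (Set.range γ) / σ) * Real.exp (-(infDist q (Set.range γ) ^ 2) / σ ^ 2)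
      - (infDist q (Set.range γ') / σ) *
          Real.exp (-(infDist q (Set.range γ') ^ 2) / σ ^ 2)|
      ≤ (1 / σ) * sInf {r : ℝ | ∃ φ ψ : Set.Icc (0 : ℝ) 1 → Set.Icc (0 : ℝ) 1,
          Continuous φ ∧ Monotone φ ∧ Function.Surjective φ ∧
          Continuous ψ ∧ Monotone ψ ∧ Function.Surjective ψ ∧
          r = ⨆ t : Set.Icc (0 : ℝ) 1, ‖γ (φ t) - γ' (ψ t)‖} := by
  have hweight : ∀ a b : ℝ, |a / σ * Real.exp (-(a ^ 2) / σ ^ 2)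
      - b / σ * Real.exp (-(b ^ 2) / σ ^ 2)| ≤ 1 / σ * |a - b| := by
    intro a b
    have h := abs_mul_exp_neg_sq_sub_le (a / σ) (b / σ)
    rwa [← sub_div, abs_div, abs_of_pos hσ, div_pow, div_pow, ← neg_div, ← neg_div,
      div_eq_inv_mul |a - b|, ← one_div] at h
  refine (hweight _ _).trans (mul_le_mul_of_nonneg_left ?_ (by positivity))
  refine le_csInf ⟨_, id, id, continuous_id, monotone_id, Function.surjective_id,
    continuous_id, monotone_id, Function.surjective_id, rfl⟩ ?_
  rintro _ ⟨φ, ψ, hφ, -, hφs, hψ, -, hψs, rfl⟩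
  exact abs_infDist_range_sub_le_iSup hφs hψs
    (isCompact_range ((hγ.comp hφ).sub (hγ'.comp hψ)).norm).bddAbove q
end
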